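/- arXiv:2009.03708 — 3 statements merged into one kernel-verified Lean document; each statement's English description precedes it below -/
import Mathlib

section
/- In the Zeckendorf game with t ≥ 3 teams each consisting of k = t − 1 consecutive players (so p = t(t−1) players total), if n ≥ 2k² + 4k, then no team has a winning strategy. -/
/-- Fibonacci numbers indexed so that `zF 1 = 1`, `zF 2 = 2`,
`zF (i+1) = zF i + zF (i-1)`. -/
def zF (n : ℕ) : ℕ := Nat.fib (n + 1)

/-- The starting state of the Zeckendorf game on `n`: `n` copies of `F 1 = 1`.
States are multisets of indices `i`, the index `i` standing for `F i`. -/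
def zstart (n : ℕ) : Multiset ℕ := Multiset.replicate n 1

/-- Legal moves of the Zeckendorf game, on multisets of indices. -/
inductive ZMove : Multiset ℕ → Multiset ℕ → Prop
  | combine (i : ℕ) (M : Multiset ℕ) (hi : 2 ≤ i) :
      ZMove ({i - 1, i} + M) ({i + 1} + M)
  | combine1 (M : Multiset ℕ) : ZMove ({1, 1} + M) ({2} + M)
  | split2 (M : Multiset ℕ) : ZMove ({2, 2} + M) ({1, 3} + M)
  | split (i : ℕ) (M : Multiset ℕ) (hi : 3 ≤ i) :
      ZMove ({i, i} + M) ({i - 2, i + 1} + M)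

/-- `ZWins p S t M` : in the `p`-player Zeckendorf game where move number `t`
(counting from 0) is made by player `t % p`, the coalition `S` of players has a
strategy from state `M` at turn `t` guaranteeing that a member of `S` makes the
final move (the move producing a state with no legal moves). -/
inductive ZWins (p : ℕ) (S : Set ℕ) : ℕ → Multiset ℕ → Prop
  | mine_end (t : ℕ) (M M' : Multiset ℕ) (hS : t % p ∈ S) (hmv : ZMove M M')
      (h : ∀ N, ¬ ZMove M' N) : ZWins p S t M
  | mine_step (t : ℕ) (M M' : Multiset ℕ) (hS : t % p ∈ S) (hmv : ZMove M M')
      (h : ZWins p S (t + 1) M') : ZWins p S t M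
  | theirs (t : ℕ) (M : Multiset ℕ) (hS : t % p ∉ S) (hne : ∃ M', ZMove M M')
      (h : ∀ M', ZMove M M' → ZWins p S (t + 1) M') : ZWins p S t M

/-- The specific move `1 + 1 = 2`. -/
def MOneOne (M M' : Multiset ℕ) : Prop :=
  ({1, 1} : Multiset ℕ) ≤ M ∧ M' = M - {1, 1} + {2}

/-- The specific move `1 + 2 = 3`. -/
def MOneTwo (M M' : Multiset ℕ) : Prop :=
  ({1, 2} : Multiset ℕ) ≤ M ∧ M' = M - {1, 2} + {3}

/-- The specific move `2 + 2 = 1 + 3`. -/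
def MTwoTwo (M M' : Multiset ℕ) : Prop :=
  ({2, 2} : Multiset ℕ) ≤ M ∧ M' = M - {2, 2} + {1, 3}

/-- Legal moves are unaffected by additional tokens. -/
theorem ZMove.add_right {M N : Multiset ℕ} (h : ZMove M N) (K : Multiset ℕ) :
    ZMove (M + K) (N + K) := by
  cases h with
  | combine i L hi => simpa only [add_assoc] using ZMove.combine i (L + K) hi
  | combine1 L => simpa only [add_assoc] using ZMove.combine1 (L + K)
  | split2 L => simpa only [add_assoc] using ZMove.split2 (L + K)
  | split i L hi => simpa only [add_assoc] using ZMove.split i (L + K) hi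

/-- A state with at least two ones has a legal move. -/
theorem ZMove.exists_of_two_le_count {M : Multiset ℕ} (h : 2 ≤ M.count 1) :
    ∃ N, ZMove M N := by
  have h2 : Multiset.replicate 2 1 ≤ M := Multiset.le_count_iff_replicate_le.mp h
  obtain ⟨K, rfl⟩ := Multiset.le_iff_exists_add.mp h2
  exact ⟨_, ZMove.combine1 K⟩

/-- A move removes at most two ones. -/
theorem ZMove.count_one_le {M N : Multiset ℕ} (h : ZMove M N) :
    M.count 1 ≤ N.count 1 + 2 := by
  cases h with
  | combine i L hi =>
    have : ({i - 1, i} : Multiset ℕ).count 1 ≤ 2 := Multiset.count_le_card _ _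
    simp only [Multiset.count_add]; omega
  | combine1 L =>
    have : ({1, 1} : Multiset ℕ).count 1 ≤ 2 := Multiset.count_le_card _ _
    simp only [Multiset.count_add]; omega
  | split2 L =>
    have : ({2, 2} : Multiset ℕ).count 1 ≤ 2 := Multiset.count_le_card _ _
    simp only [Multiset.count_add]; omega
  | split i L hi =>
    have : ({i, i} : Multiset ℕ).count 1 ≤ 2 := Multiset.count_le_card _ _
    simp only [Multiset.count_add]; omega

/-- `MovesIn m M N`: the state `N` can be reached from `M` in exactly `m` moves. -/
inductive MovesIn : ℕ → Multiset ℕ → Multiset ℕ → Prop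
  | refl (M : Multiset ℕ) : MovesIn 0 M M
  | step {m : ℕ} {M N P : Multiset ℕ} : ZMove M N → MovesIn m N P → MovesIn (m + 1) M P

namespace MovesIn

theorem add_right {m : ℕ} {M N : Multiset ℕ} (h : MovesIn m M N) (K : Multiset ℕ) :
    MovesIn m (M + K) (N + K) := by
  induction h with
  | refl M => exact .refl _
  | step h _ ih => exact .step (h.add_right K) ih

theorem trans {m l : ℕ} {M N P : Multiset ℕ} (h : MovesIn m M N) (h' : MovesIn l N P) :
    MovesIn (l + m) M P := by
  induction h with
  | refl M => exact h'
  | step h _ ih => exact .step h (ih h')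

theorem combine {m : ℕ} {M P : Multiset ℕ} (i : ℕ) (L : Multiset ℕ) (hi : 2 ≤ i)
    (hM : M = {i - 1, i} + L) (h : MovesIn m ({i + 1} + L) P) : MovesIn (m + 1) M P :=
  hM ▸ .step (.combine i L hi) h

theorem combine1 {m : ℕ} {M P : Multiset ℕ} (L : Multiset ℕ)
    (hM : M = {1, 1} + L) (h : MovesIn m ({2} + L) P) : MovesIn (m + 1) M P :=
  hM ▸ .step (.combine1 L) h

theorem split2 {m : ℕ} {M P : Multiset ℕ} (L : Multiset ℕ)
    (hM : M = {2, 2} + L) (h : MovesIn m ({1, 3} + L) P) : MovesIn (m + 1) M P :=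
  hM ▸ .step (.split2 L) h

theorem split {m : ℕ} {M P : Multiset ℕ} (i : ℕ) (L : Multiset ℕ) (hi : 3 ≤ i)
    (hM : M = {i, i} + L) (h : MovesIn m ({i - 2, i + 1} + L) P) : MovesIn (m + 1) M P :=
  hM ▸ .step (.split i L hi) h

theorem of_eq {M N : Multiset ℕ} (h : M = N) : MovesIn 0 M N := h ▸ .refl M

theorem ones_to_three_two : MovesIn 2 {1, 1, 1} {3} :=
  .combine1 {1} (by decide) <| .combine 2 0 (by decide) (by decide) <| of_eq (by decide)

theorem ones_to_three_three : MovesIn 3 {1, 1, 1, 1} {1, 3} :=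
  .combine1 {1, 1} (by decide) <| .combine1 {2} (by decide) <| .split2 0 (by decide) <|
    of_eq (by decide)

theorem ones_to_four : MovesIn 4 {1, 1, 1, 1, 1} {4} :=
  .combine1 {1, 1, 1} (by decide) <| .combine 2 {1, 1} (by decide) (by decide) <|
    .combine1 {3} (by decide) <| .combine 3 0 (by decide) (by decide) <| of_eq (by decide)

theorem four_to_five : MovesIn 4 {1, 1, 1, 1, 4} {1, 5} :=
  .combine1 {1, 1, 4} (by decide) <| .combine1 {2, 4} (by decide) <|
    .split2 {4} (by decide) <| .combine 4 {1} (by decide) (by decide) <| of_eq (by decide)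

theorem two_twos_two : MovesIn 2 {1, 1, 1, 2, 2} {1, 3, 3} :=
  .combine 2 {1, 1, 2} (by decide) (by decide) <| .combine 2 {1, 3} (by decide) (by decide) <|
    of_eq (by decide)

theorem two_twos_four : MovesIn 4 {1, 1, 1, 2, 2} {1, 3, 3} :=
  .combine1 {1, 2, 2} (by decide) <| .split2 {1, 2} (by decide) <|
    .combine1 {2, 3} (by decide) <| .split2 {3} (by decide) <| of_eq (by decide)

theorem three_two : MovesIn 2 {1, 1, 1, 1, 3} {1, 1, 4} :=
  .combine1 {1, 1, 3} (by decide) <| .combine 3 {1, 1} (by decide) (by decide) <|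
    of_eq (by decide)

theorem three_four : MovesIn 4 {1, 1, 1, 1, 3} {1, 1, 4} :=
  .combine1 {1, 1, 3} (by decide) <| .combine1 {2, 3} (by decide) <|
    .split2 {3} (by decide) <| .split 3 {1} (by decide) (by decide) <| of_eq (by decide)

/-- From sufficiently many ones, a common state is reachable in `2 * m` and in `3 * m` moves. -/
theorem exists_two_mul_three_mul (m : ℕ) : ∀ N : Multiset ℕ, ∃ X,
    MovesIn (2 * m) (N + Multiset.replicate (3 * m + 1) 1) X ∧
    MovesIn (3 * m) (N + Multiset.replicate (3 * m + 1) 1) X := by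
  induction m with
  | zero => exact fun N => ⟨_, .refl _, .refl _⟩
  | succ m ih =>
    intro N
    obtain ⟨X, h2, h3⟩ := ih (N + {3})
    have e : N + {3} + Multiset.replicate (3 * m + 1) 1
        = {3} + (N + Multiset.replicate (3 * m + 1) 1) := by abel
    have e' : N + {3} + Multiset.replicate (3 * m + 1) 1
        = {1, 3} + (N + Multiset.replicate (3 * m) 1) := by
      rw [Multiset.replicate_add, Multiset.replicate_one]
      simp only [Multiset.insert_eq_cons, ← Multiset.singleton_add]; abel
    refine ⟨X, ?_, ?_⟩
    · have := (ones_to_three_two.add_right _).trans (e ▸ h2)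
      rw [mul_add_one 2]
      convert this using 1
      rw [show 3 * (m + 1) + 1 = 3 + (3 * m + 1) by ring, Multiset.replicate_add 3,
        show Multiset.replicate 3 1 = {1, 1, 1} from rfl]
      abel
    · have := (ones_to_three_three.add_right _).trans (e' ▸ h3)
      rw [show 3 * (m + 1) + 1 = 4 + 3 * m by ring, mul_add_one 3]
      convert this using 1
      rw [Multiset.replicate_add 4,
        show Multiset.replicate 4 1 = {1, 1, 1, 1} from rfl]
      abel

end MovesIn

namespace ZWins

variable {p : ℕ} {S : Set ℕ} {T : ℕ} {M : Multiset ℕ}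

theorem exists_move (h : ZWins p S T M) : ∃ N, ZMove M N := by
  cases h with
  | mine_end _ _ M' _ hmv _ => exact ⟨_, hmv⟩
  | mine_step _ _ M' _ hmv _ => exact ⟨_, hmv⟩
  | theirs _ _ _ hne _ => exact hne

theorem exists_step (h : ZWins p S T M) (hM : 4 ≤ M.count 1) :
    ∃ N, ZMove M N ∧ ZWins p S (T + 1) N := by
  cases h with
  | mine_end _ _ M' _ hmv hend =>
    have := hmv.count_one_le
    obtain ⟨N, hN⟩ := ZMove.exists_of_two_le_count (M := M') (by omega)
    exact (hend N hN).elim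
  | mine_step _ _ M' _ hmv h => exact ⟨_, hmv, h⟩
  | theirs _ _ _ hne h => exact hne.imp fun M' hM' => ⟨hM', h M' hM'⟩

theorem of_move {N : Multiset ℕ} (h : ZWins p S T M) (hT : T % p ∉ S) (hmv : ZMove M N) :
    ZWins p S (T + 1) N := by
  cases h with
  | mine_end _ _ M' hS _ _ => exact (hT hS).elim
  | mine_step _ _ M' hS _ _ => exact (hT hS).elim
  | theirs _ _ _ _ h => exact h N hmv

theorem of_movesIn {m : ℕ} {N : Multiset ℕ} (hmv : MovesIn m M N) :
    ∀ {T : ℕ}, ZWins p S T M → (∀ i < m, (T + i) % p ∉ S) → ZWins p S (T + m) N := by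
  induction hmv with
  | refl M => exact fun h _ => h
  | @step m M N P hmv _ ih =>
    intro T h hT
    have := ih (h.of_move (hT 0 (by omega)) hmv) fun i hi => by
      rw [add_right_comm]; exact hT (i + 1) (by omega)
    rwa [add_right_comm] at this

/-- Disjoint coalitions cannot both win from the same state. -/
theorem false_of_disjoint {S' : Set ℕ} (h : ZWins p S T M) :
    ∀ {T' : ℕ}, ZWins p S' T' M →
      (∀ i, (T + i) % p ∈ S → (T' + i) % p ∉ S') → False := by
  induction h with
  | mine_end T M M' hS hmv hend =>
    intro T' h' hd
    obtain ⟨N, hN⟩ := (h'.of_move (hd 0 hS) hmv).exists_move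
    exact hend N hN
  | mine_step T M M' hS hmv _ ih =>
    intro T' h' hd
    refine ih (h'.of_move (hd 0 hS) hmv) fun i hi => ?_
    have := hd (i + 1)
    rw [add_right_comm] at hi ⊢
    exact this hi
  | theirs T M hS hne h ih =>
    intro T' h' hd
    have hd' : ∀ i, (T + 1 + i) % p ∈ S → (T' + 1 + i) % p ∉ S' := fun i hi => by
      rw [add_right_comm] at hi ⊢
      exact hd (i + 1) hi
    cases h' with
    | mine_end _ _ M' _ hmv hend =>
      obtain ⟨N, hN⟩ := (h M' hmv).exists_move
      exact hend N hN
    | mine_step _ _ M' _ hmv h' => exact ih M' hmv h' hd'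
    | theirs _ _ _ hne h' =>
      obtain ⟨M', hmv⟩ := hne
      exact ih M' hmv (h' M' hmv) hd'

/-- After `s` moves at most `2 * s` ones have been used. -/
theorem exists_after (s : ℕ) : ∀ {T : ℕ} {M : Multiset ℕ}, ZWins p S T M →
    ∀ c, 2 ≤ c → 2 * s + c ≤ M.count 1 → ∃ N, c ≤ N.count 1 ∧ ZWins p S (T + s) N := by
  induction s with
  | zero => exact fun h c _ hM => ⟨_, by omega, h⟩
  | succ s ih =>
    intro T M h c hc hM
    obtain ⟨N, hmv, hN⟩ := h.exists_step (by omega)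
    have := hmv.count_one_le
    obtain ⟨P, hP, h'⟩ := ih hN c hc (by omega)
    exact ⟨P, hP, by rwa [add_right_comm] at h'⟩

end ZWins

theorem mod_mul_div_eq (t k x : ℕ) : x % (t * k) / k = x / k % t := by
  rw [mul_comm, Nat.mod_mul_right_div_self]

/-- Strategy stealing: if the opponents of team `j` can reach a common state after numbers of moves
differing by the team size, then team `j` has no winning strategy. -/
theorem ZWins.false_of_shift {t k j T m : ℕ} {M X : Multiset ℕ} (ht : 2 ≤ t) (hk : 0 < k)
    (h : ZWins (t * k) {i | i / k = j} T M)
    (hT : ∀ i < m + k, (T + i) / k % t ≠ j)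
    (h1 : MovesIn m M X) (h2 : MovesIn (m + k) M X) : False := by
  have hS : ∀ i < m + k, (T + i) % (t * k) ∉ {i | i / k = j} := fun i hi => by
    rw [Set.mem_ofPred_eq, mod_mul_div_eq]; exact hT i hi
  refine (ZWins.of_movesIn h1 h fun i hi => hS i (by omega)).false_of_disjoint
    (ZWins.of_movesIn h2 h hS) fun i hi => ?_
  rw [Set.mem_ofPred_eq, mod_mul_div_eq] at hi ⊢
  rw [show T + (m + k) + i = T + m + i + k by ring, Nat.add_div_right _ hk]
  intro h'
  have hmod : (T + m + i) / k + 1 ≡ (T + m + i) / k [MOD t] := h'.trans hi.symm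
  have : 1 ≡ 0 [MOD t] := Nat.ModEq.add_left_cancel' _ hmod
  rw [Nat.modEq_zero_iff_dvd, Nat.dvd_one] at this
  omega

/-- Players in the `t - 1` blocks preceding or following block `j` do not belong to team `j`. -/
theorem div_mod_ne_of_block {t k j x : ℕ} (hk : 0 < k) (hj : j < t)
    (hx : x < j * k ∨ ((j + 1) * k ≤ x ∧ x < (j + t) * k)) : x / k % t ≠ j := by
  rcases hx with hx | ⟨h1, h2⟩
  · have : x / k < j := (Nat.div_lt_iff_lt_mul hk).mpr hx
    rw [Nat.mod_eq_of_lt (by omega)]; omega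
  · have hl : j + 1 ≤ x / k := (Nat.le_div_iff_mul_le hk).mpr h1
    have hu : x / k < j + t := (Nat.div_lt_iff_lt_mul hk).mpr h2
    rcases lt_or_ge (x / k) t with h | h
    · rw [Nat.mod_eq_of_lt h]; omega
    · rw [Nat.mod_eq_sub_mod h, Nat.mod_eq_of_lt (by omega)]; omega

theorem not_zWins_of_three_le {k n j : ℕ} (hk : 3 ≤ k) (hn : 2 * k ^ 2 + 4 * k ≤ n)
    (hj : j < k + 1) : ¬ ZWins ((k + 1) * k) {i | i / k = j} 0 (zstart n) := by
  intro h
  have key : ∀ {T M}, ZWins ((k + 1) * k) {i | i / k = j} T M → 3 * k + 1 ≤ M.count 1 →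
      (∀ i < 3 * k, (T + i) / k % (k + 1) ≠ j) → False := by
    intro T M h hM hT
    obtain ⟨K, rfl⟩ := Multiset.le_iff_exists_add.mp (Multiset.le_count_iff_replicate_le.mp hM)
    obtain ⟨X, h2, h3⟩ := MovesIn.exists_two_mul_three_mul k K
    rw [add_comm] at h2 h3
    exact h.false_of_shift (by omega) (by omega) (fun i hi => hT i (by omega)) h2
      (by rwa [show 2 * k + k = 3 * k by ring])
  rcases lt_or_ge j 3 with h3 | h3
  · obtain ⟨M, hM, h'⟩ := h.exists_after ((j + 1) * k) (3 * k + 1) (by omega) (by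
      simp only [zstart, Multiset.count_replicate_self]; nlinarith)
    refine key h' hM fun i hi => div_mod_ne_of_block (by omega) hj (.inr ⟨by omega, ?_⟩)
    nlinarith
  · refine key h ?_ fun i hi => div_mod_ne_of_block (by omega) hj (.inl ?_)
    · simp only [zstart, Multiset.count_replicate_self]; nlinarith
    · nlinarith

section Inversion

variable {B M : Multiset ℕ} {a : ℕ}

theorem count_add_replicate_of_ne {x : ℕ} (hx : x ≠ 1) :
    (B + Multiset.replicate a 1).count x = B.count x := by
  simp [Multiset.count_replicate, hx.symm]

/-- The only move from isolated tokens of index at least `3` together with ones is `1 + 1 = 2`. -/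
theorem ZMove.eq_of_isolated (h3 : ∀ i ∈ B, 3 ≤ i) (hB : B.Nodup) (hadj : ∀ i ∈ B, i + 1 ∉ B)
    (h : ZMove (B + Multiset.replicate (a + 2) 1) M) :
    M = B + {2} + Multiset.replicate a 1 := by
  generalize hL : B + Multiset.replicate (a + 2) 1 = L at h
  have hcount : ∀ x, x ≠ 1 → L.count x = B.count x := fun x hx => by
    rw [← hL, count_add_replicate_of_ne hx]
  have hmem : ∀ x, x ≠ 1 → x ∈ L → x ∈ B := fun x hx hxL => by
    rw [← Multiset.count_pos] at hxL ⊢; rwa [← hcount x hx]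
  have hdup : ∀ x K, x ≠ 1 → L ≠ {x, x} + K := by
    intro x K hx hLK
    have h1 := hcount x hx
    have h2 := Multiset.nodup_iff_count_le_one.mp hB x
    rw [hLK, Multiset.count_add] at h1
    simp at h1; omega
  generalize hL' : L = L' at h
  cases h with
  | combine i K hi =>
    have h1 := hmem i (by omega) (by simp [hL'])
    have h2 := h3 i h1
    have h4 := hadj (i - 1) (hmem (i - 1) (by omega) (by simp [hL']))
    rw [show i - 1 + 1 = i by omega] at h4
    exact (h4 h1).elim
  | combine1 K =>
    have : {1, 1} + K = {1, 1} + (B + Multiset.replicate a 1) := by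
      rw [← hL', ← hL, Multiset.replicate_add, show Multiset.replicate 2 1 = {1, 1} from rfl]
      abel
    rw [add_left_cancel this]; abel
  | split2 K => exact (hdup 2 K (by omega) hL').elim
  | split i K hi => exact (hdup i K (by omega) hL').elim

/-- The moves from isolated tokens of index at least `3` together with one `2` and some ones. -/
theorem ZMove.cases_of_isolated_two (h3 : ∀ i ∈ B, 3 ≤ i) (hB : B.Nodup)
    (hadj : ∀ i ∈ B, i + 1 ∉ B) (h : ZMove (B + {2} + Multiset.replicate (a + 2) 1) M) :
    M = B + {2, 2} + Multiset.replicate a 1 ∨ M = B + {3} + Multiset.replicate (a + 1) 1 ∨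
      (3 ∈ B ∧ M = B.erase 3 + {4} + Multiset.replicate (a + 2) 1) := by
  generalize hL : B + {2} + Multiset.replicate (a + 2) 1 = L at h
  have h2B : 2 ∉ B := fun h => by have := h3 2 h; omega
  have hB2 : (B + {2}).Nodup := by
    rw [add_comm, Multiset.singleton_add, Multiset.nodup_cons]; exact ⟨h2B, hB⟩
  have hcount : ∀ x, x ≠ 1 → L.count x = (B + {2}).count x := fun x hx => by
    rw [← hL, count_add_replicate_of_ne hx]
  have hmem : ∀ x, x ≠ 1 → x ∈ L → x ∈ B + {2} := fun x hx hxL => by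
    rw [← Multiset.count_pos] at hxL ⊢; rwa [← hcount x hx]
  have hdup : ∀ x K, x ≠ 1 → L ≠ {x, x} + K := by
    intro x K hx hLK
    have h1 := hcount x hx
    have h2 := Multiset.nodup_iff_count_le_one.mp hB2 x
    rw [hLK, Multiset.count_add] at h1
    simp only [Multiset.insert_eq_cons, Multiset.count_cons_self,
      Multiset.count_singleton_self] at h1
    omega
  generalize hL' : L = L' at h
  cases h with
  | combine i K hi =>
    rcases (show i = 2 ∨ i = 3 ∨ 4 ≤ i by omega) with rfl | rfl | hi4
    · right; left
      have : {2 - 1, 2} + K = {2 - 1, 2} + (B + Multiset.replicate (a + 1) 1) := by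
        rw [← hL', ← hL, Multiset.replicate_succ]
        simp only [Multiset.insert_eq_cons, ← Multiset.singleton_add]
        abel
      rw [add_left_cancel this]; abel
    · right; right
      have h1 : 3 ∈ B := by simpa using hmem 3 (by omega) (by simp [hL'])
      refine ⟨h1, ?_⟩
      have : {3 - 1, 3} + K = {3 - 1, 3} + (B.erase 3 + Multiset.replicate (a + 2) 1) := by
        rw [← hL', ← hL]
        nth_rewrite 1 [← Multiset.cons_erase h1]
        simp only [Multiset.insert_eq_cons, ← Multiset.singleton_add]
        abel
      rw [add_left_cancel this]; abel
    · have h1 : i ∈ B := by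
        have := hmem i (by omega) (by simp [hL'])
        simp only [Multiset.mem_add, Multiset.mem_singleton] at this
        exact this.resolve_right (by omega)
      have h2 : i - 1 ∈ B := by
        have := hmem (i - 1) (by omega) (by simp [hL'])
        simp only [Multiset.mem_add, Multiset.mem_singleton] at this
        exact this.resolve_right (by omega)
      have h4 := hadj (i - 1) h2
      rw [show i - 1 + 1 = i by omega] at h4
      exact (h4 h1).elim
  | combine1 K =>
    left
    have : {1, 1} + K = {1, 1} + (B + {2} + Multiset.replicate a 1) := by
      rw [← hL', ← hL, Multiset.replicate_add, show Multiset.replicate 2 1 = {1, 1} from rfl]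
      abel
    rw [add_left_cancel this]
    simp only [Multiset.insert_eq_cons, ← Multiset.singleton_add]
    abel
  | split2 K => exact (hdup 2 K (by omega) hL').elim
  | split i K hi => exact (hdup i K (by omega) hL').elim

/-- The possible outcomes of two moves from isolated tokens of index at least `3` together with
ones. -/
theorem ZWins.cases_two_moves {p : ℕ} {S : Set ℕ} {T : ℕ} (h3 : ∀ i ∈ B, 3 ≤ i) (hB : B.Nodup)
    (hadj : ∀ i ∈ B, i + 1 ∉ B) (h : ZWins p S T (B + Multiset.replicate (a + 6) 1)) :
    ZWins p S (T + 2) (B + {2, 2} + Multiset.replicate (a + 2) 1) ∨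
      ZWins p S (T + 2) (B + {3} + Multiset.replicate (a + 3) 1) ∨
      (3 ∈ B ∧ ZWins p S (T + 2) (B.erase 3 + {4} + Multiset.replicate (a + 4) 1)) := by
  obtain ⟨N, hN, h⟩ := h.exists_step (by simp)
  obtain rfl := hN.eq_of_isolated h3 hB hadj
  obtain ⟨P, hP, h⟩ := h.exists_step (by simp)
  rcases hP.cases_of_isolated_two h3 hB hadj with rfl | rfl | ⟨h', rfl⟩
  · exact .inl h
  · exact .inr (.inl h)
  · exact .inr (.inr ⟨h', h⟩)

end Inversion

section TeamsOfTwo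

variable {T j a : ℕ} {B : Multiset ℕ}

theorem not_zWins_two_twos (hT : ∀ i < 4, (T + i) / 2 % 3 ≠ j) :
    ¬ ZWins (3 * 2) {i | i / 2 = j} T (B + {2, 2} + Multiset.replicate (a + 3) 1) := by
  intro h
  have e : B + {2, 2} + Multiset.replicate (a + 3) 1
      = {1, 1, 1, 2, 2} + (B + Multiset.replicate a 1) := by
    rw [Multiset.replicate_add, show Multiset.replicate 3 1 = {1, 1, 1} from rfl]
    simp only [Multiset.insert_eq_cons, ← Multiset.singleton_add]
    abel
  rw [e] at h
  exact h.false_of_shift (m := 2) (by omega) (by omega) hT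
    (MovesIn.two_twos_two.add_right _) (MovesIn.two_twos_four.add_right _)

theorem not_zWins_three (hT : ∀ i < 4, (T + i) / 2 % 3 ≠ j) :
    ¬ ZWins (3 * 2) {i | i / 2 = j} T (B + {3} + Multiset.replicate (a + 4) 1) := by
  intro h
  have e : B + {3} + Multiset.replicate (a + 4) 1
      = {1, 1, 1, 1, 3} + (B + Multiset.replicate a 1) := by
    rw [Multiset.replicate_add, show Multiset.replicate 4 1 = {1, 1, 1, 1} from rfl]
    simp only [Multiset.insert_eq_cons, ← Multiset.singleton_add]
    abel
  rw [e] at h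
  exact h.false_of_shift (m := 2) (by omega) (by omega) hT
    (MovesIn.three_two.add_right _) (MovesIn.three_four.add_right _)

/-- From isolated tokens of index at least `3` together with ones, if team `j` moves twice and then
the other teams move four times, the only way for team `j` to keep a winning position is to turn a
`3` into a `4`. -/
theorem ZWins.erase_three (h3 : ∀ i ∈ B, 3 ≤ i) (hB : B.Nodup) (hadj : ∀ i ∈ B, i + 1 ∉ B)
    (hT : ∀ i < 4, (T + 2 + i) / 2 % 3 ≠ j)
    (h : ZWins (3 * 2) {i | i / 2 = j} T (B + Multiset.replicate (a + 7) 1)) :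
    3 ∈ B ∧ ZWins (3 * 2) {i | i / 2 = j} (T + 2)
      (B.erase 3 + {4} + Multiset.replicate (a + 5) 1) := by
  rcases h.cases_two_moves (a := a + 1) h3 hB hadj with h | h | h
  · exact (not_zWins_two_twos hT h).elim
  · exact (not_zWins_three hT h).elim
  · exact h

theorem not_zWins_of_two {n : ℕ} (hn : 16 ≤ n) (hj : j < 3) :
    ¬ ZWins (3 * 2) {i | i / 2 = j} 0 (zstart n) := by
  intro h
  obtain ⟨a, rfl⟩ := Nat.exists_eq_add_of_le' hn
  unfold zstart at h
  have opp : ∀ {T m M N}, MovesIn m M N → ZWins (3 * 2) {i | i / 2 = j} T M →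
      (∀ i < m, (T + i) / 2 % 3 ≠ j) → ZWins (3 * 2) {i | i / 2 = j} (T + m) N :=
    fun hmv h hT => ZWins.of_movesIn hmv h fun i hi => by
      rw [Set.mem_ofPred_eq, mod_mul_div_eq]; exact hT i hi
  interval_cases j
  · have := (ZWins.erase_three (T := 0) (j := 0) (B := 0) (a := a + 9) (by simp) (by simp)
      (by simp) (by decide) (by rwa [zero_add])).1
    simp at this
  · rw [show a + 16 = 3 + (a + 13) by ring, Multiset.replicate_add] at h
    have h1 := (ZWins.erase_three (a := a + 6) (by simp) (by simp) (by simp) (by decide)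
      (opp (MovesIn.ones_to_three_two.add_right _) h (by decide))).2
    have e : Multiset.erase {3} 3 + {4} + Multiset.replicate (a + 6 + 5) 1
        = {1, 1, 1, 1, 4} + Multiset.replicate (a + 7) 1 := by
      rw [show a + 6 + 5 = 4 + (a + 7) by ring, Multiset.replicate_add,
        show Multiset.replicate 4 1 = {1, 1, 1, 1} from rfl, Multiset.erase_singleton]
      simp only [Multiset.insert_eq_cons, ← Multiset.singleton_add]
      abel
    rw [e] at h1
    have h2 := opp (MovesIn.four_to_five.add_right _) h1 (by decide)
    have e' : {1, 5} + Multiset.replicate (a + 7) 1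
        = {5} + Multiset.replicate (a + 1 + 7) 1 := by
      rw [show a + 1 + 7 = 1 + (a + 7) by ring, Multiset.replicate_add 1 (a + 7),
        Multiset.replicate_one]
      simp only [Multiset.insert_eq_cons, ← Multiset.singleton_add]
      abel
    rw [e'] at h2
    have := (h2.erase_three (by simp) (by simp) (by simp) (by decide)).1
    simp at this
  · rw [show a + 16 = 5 + (a + 11) by ring, Multiset.replicate_add] at h
    have := (ZWins.erase_three (a := a + 4) (by simp) (by simp) (by simp) (by decide)
      (opp (MovesIn.ones_to_four.add_right _) h (by decide))).1
    simp at this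

end TeamsOfTwo

/-- In the Zeckendorf game with `t ≥ 3` teams each of `k = t - 1` consecutive
players (so `p = t(t-1)` players, team `j` consisting of the players `i` with
`i / k = j`), if `n ≥ 2k² + 4k` then no team has a winning strategy. -/
theorem stmt_11 (t n : ℕ) (ht : 3 ≤ t)
    (hn : 2 * (t - 1) ^ 2 + 4 * (t - 1) ≤ n) :
    ∀ j < t, ¬ ZWins (t * (t - 1)) {i | i / (t - 1) = j} 0 (zstart n) := by
  intro j hj
  obtain ⟨k, rfl⟩ := Nat.exists_eq_add_of_le' (show 1 ≤ t by omega)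
  simp only [Nat.add_sub_cancel] at hn ⊢
  rcases (show k = 2 ∨ 3 ≤ k by omega) with rfl | hk
  · exact not_zWins_of_two (by omega) hj
  · exact not_zWins_of_three_le hk hn hj
end

section
/- In the 6-player Zeckendorf game with n ≥ 30 and two alliances, one of 4 players and one of 2 players, the 4-player alliance always has a winning strategy, regardless of the seating arrangement of the alliances. -/
/-- A weight on multisets of indices that drops at every move. -/
def zweight (M : Multiset ℕ) : ℕ := (M.map fun i => if i ≤ 1 then 3 else i + 3).sum

theorem ZMove.zweight_lt {M M' : Multiset ℕ} (h : ZMove M M') : zweight M' < zweight M := by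
  cases h <;>
    simp only [zweight, Multiset.insert_eq_cons, Multiset.map_add, Multiset.map_cons,
      Multiset.map_singleton, Multiset.sum_add, Multiset.sum_cons, Multiset.sum_singleton] <;>
    split_ifs <;> omega

section Coalition

variable {p : ℕ} {S : Set ℕ} {t : ℕ} {M M' : Multiset ℕ}

theorem not_zWins_succ (hS : t % p ∈ S) (h : ¬ ZWins p S t M) (hmv : ZMove M M') :
    ¬ ZWins p S (t + 1) M' :=
  fun hw => h (.mine_step t M M' hS hmv hw)

theorem exists_zMove_not_zWins_succ (h : ¬ ZWins p S t M) (hne : ∃ M', ZMove M M') :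
    ∃ M', ZMove M M' ∧ ¬ ZWins p S (t + 1) M' := by
  by_cases hS : t % p ∈ S
  · obtain ⟨M', hmv⟩ := hne
    exact ⟨M', hmv, not_zWins_succ hS h hmv⟩
  · by_contra! hall
    exact h (.theirs t M hS hne hall)

/-- Strategy stealing: if rotating the opponents by `k` seats places all of them in `S`, and the
opponents win with `t` to move, then `S` wins with `t + k` to move. -/
theorem zWins_add_of_not_zWins {k : ℕ} (hk : ∀ t, t % p ∉ S → (t + k) % p ∈ S)
    (hne : ∃ M', ZMove M M') (h : ¬ ZWins p S t M) : ZWins p S (t + k) M := by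
  induction hw : zweight M using Nat.strong_induction_on generalizing M t with
  | _ w ih =>
    subst hw
    have step : ∀ M', ZMove M M' → (∃ N, ZMove M' N) → ¬ ZWins p S (t + 1) M' →
        ZWins p S (t + k + 1) M' := fun M' hmv hM' hl => by
      rw [add_right_comm]
      exact ih _ hmv.zweight_lt hM' hl rfl
    by_cases hS : t % p ∈ S
    · have win : ∀ M', ZMove M M' → ZWins p S (t + k + 1) M' := fun M' hmv => by
        refine step M' hmv ?_ (not_zWins_succ hS h hmv)
        by_contra! hend
        exact h (.mine_end t M M' hS hmv hend)
      by_cases hS' : (t + k) % p ∈ S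
      · obtain ⟨M', hmv⟩ := hne
        exact .mine_step _ M M' hS' hmv (win M' hmv)
      · exact .theirs _ M hS' hne win
    · obtain ⟨M', hmv, hl⟩ := exists_zMove_not_zWins_succ h hne
      by_cases hM' : ∃ N, ZMove M' N
      · exact .mine_step _ M M' (hk t hS) hmv (step M' hmv hM' hl)
      · exact .mine_end _ M M' (hk t hS) hmv (not_exists.mp hM')

end Coalition

/-- The state with `a`, `b`, `c`, `d` copies of the indices `1`, `2`, `3`, `4` added to `R`. -/
def zstate (a b c d : ℕ) (R : Multiset ℕ) : Multiset ℕ :=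
  a • {1} + b • {2} + c • {3} + d • {4} + R

section Moves

variable (a b c d : ℕ) (R : Multiset ℕ)

theorem zMove_one_one : ZMove (zstate (a + 2) b c d R) (zstate a (b + 1) c d R) := by
  convert ZMove.combine1 (zstate a b c d R) using 1 <;>
    simp only [zstate, Multiset.insert_eq_cons, ← Multiset.singleton_add, add_smul] <;> abel

theorem zMove_one_two : ZMove (zstate (a + 1) (b + 1) c d R) (zstate a b (c + 1) d R) := by
  convert ZMove.combine 2 (zstate a b c d R) le_rfl using 1 <;>
    simp only [zstate, Multiset.insert_eq_cons, ← Multiset.singleton_add, add_smul] <;> abel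

theorem zMove_two_two : ZMove (zstate a (b + 2) c d R) (zstate (a + 1) b (c + 1) d R) := by
  convert ZMove.split2 (zstate a b c d R) using 1 <;>
    simp only [zstate, Multiset.insert_eq_cons, ← Multiset.singleton_add, add_smul] <;> abel

theorem zMove_two_three : ZMove (zstate a (b + 1) (c + 1) d R) (zstate a b c (d + 1) R) := by
  convert ZMove.combine 3 (zstate a b c d R) (by norm_num) using 1 <;>
    simp only [zstate, Multiset.insert_eq_cons, ← Multiset.singleton_add, add_smul] <;> abel

theorem zMove_three_three : ZMove (zstate a b (c + 2) d R) (zstate (a + 1) b c (d + 1) R) := by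
  convert ZMove.split 3 (zstate a b c d R) le_rfl using 1 <;>
    simp only [zstate, Multiset.insert_eq_cons, ← Multiset.singleton_add, add_smul] <;> abel

end Moves

theorem exists_eq_zstate {M : Multiset ℕ} {a b c : ℕ} (ha : a ≤ M.count 1) (hb : b ≤ M.count 2)
    (hc : c ≤ M.count 3) : ∃ R, M = zstate a b c 0 R := by
  have hle : zstate a b c 0 0 ≤ M := by
    rw [Multiset.le_iff_count]
    intro x
    simp only [zstate, Multiset.count_add, Multiset.count_nsmul, Multiset.count_singleton,
      Multiset.count_zero]
    split_ifs <;> subst_vars <;> omega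
  obtain ⟨R, rfl⟩ := Multiset.le_iff_exists_add.mp hle
  exact ⟨R, by simp [zstate]⟩

theorem exists_zMove_of_count_one {M : Multiset ℕ} (h : 2 ≤ M.count 1) : ∃ M', ZMove M M' := by
  obtain ⟨R, rfl⟩ := exists_eq_zstate (b := 0) (c := 0) h (Nat.zero_le _) (Nat.zero_le _)
  exact ⟨_, zMove_one_one 0 0 0 0 R⟩

theorem count_zstate (a b c d : ℕ) (R : Multiset ℕ) :
    (zstate a b c d R).count 1 = a + R.count 1 ∧ (zstate a b c d R).count 2 = b + R.count 2 ∧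
      (zstate a b c d R).count 3 = c + R.count 3 := by
  simp [zstate]

/-- The possible effects of a move on the numbers of `1`s, `2`s and `3`s. -/
theorem ZMove.count_cases {M M' : Multiset ℕ} (h : ZMove M M') :
    (M.count 1 = M'.count 1 + 2 ∧ M'.count 2 = M.count 2 + 1 ∧ M'.count 3 = M.count 3) ∨
    (M.count 1 = M'.count 1 + 1 ∧ M.count 2 = M'.count 2 + 1 ∧ M'.count 3 = M.count 3 + 1) ∨
    (M'.count 1 = M.count 1 + 1 ∧ M.count 2 = M'.count 2 + 2 ∧ M'.count 3 = M.count 3 + 1) ∨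
    (M'.count 1 = M.count 1 ∧ M.count 2 = M'.count 2 + 1 ∧ M.count 3 = M'.count 3 + 1) ∨
    (M'.count 1 = M.count 1 + 1 ∧ M'.count 2 = M.count 2 ∧ M.count 3 = M'.count 3 + 2) ∨
    (M'.count 1 = M.count 1 ∧ M'.count 2 = M.count 2 ∧ M.count 3 = M'.count 3 + 1) ∨
    (M'.count 1 = M.count 1 ∧ M.count 2 ≤ M'.count 2 ∧ M.count 3 ≤ M'.count 3) := by
  obtain ⟨i, N, hi⟩ | N | N | ⟨i, N, hi⟩ := h
  · obtain rfl | rfl | rfl | hi : i = 2 ∨ i = 3 ∨ i = 4 ∨ 5 ≤ i := by omega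
    · right; left; simp
    · right; right; right; left; simp
    · right; right; right; right; right; left; simp
    · iterate 6 right
      have h1 : 1 ≠ i - 1 ∧ 1 ≠ i ∧ 1 ≠ i + 1 := by omega
      have h2 : 2 ≠ i - 1 ∧ 2 ≠ i ∧ 2 ≠ i + 1 := by omega
      have h3 : 3 ≠ i - 1 ∧ 3 ≠ i ∧ 3 ≠ i + 1 := by omega
      simp [Multiset.count_cons, h1, h2, h3]
      omega
  · left; simp
  · right; right; left; simp
  · obtain rfl | hi : i = 3 ∨ 4 ≤ i := by omega
    · right; right; right; right; left; simp
    · iterate 6 right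
      have h1 : 1 ≠ i - 2 ∧ 1 ≠ i ∧ 1 ≠ i + 1 := by omega
      have h2 : 2 ≠ i ∧ 2 ≠ i + 1 := by omega
      have h3 : 3 ≠ i ∧ 3 ≠ i + 1 := by omega
      simp [Multiset.count_cons, h1, h2, h3]
      omega

theorem ZMove.eq_of_count_two {M M' : Multiset ℕ} (h : ZMove M M')
    (hc : M'.count 2 + 2 ≤ M.count 2) : ∃ N, M = {2, 2} + N ∧ M' = {1, 3} + N := by
  obtain ⟨i, N, hi⟩ | N | N | ⟨i, N, hi⟩ := h
  · have : ¬ (2 = i - 1 ∧ 2 = i) := by omega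
    simp only [Multiset.insert_eq_cons, Multiset.count_add, Multiset.count_cons,
      Multiset.count_singleton] at hc
    split_ifs at hc <;> omega
  · simp at hc
    omega
  · exact ⟨N, rfl, rfl⟩
  · have : 2 ≠ i := by omega
    simp [Multiset.count_cons, this] at hc
    split_ifs at hc <;> omega

theorem ZMove.zstate_eq {a : ℕ} {R M' : Multiset ℕ} (h : ZMove (zstate a 2 0 0 R) M')
    (hR : R.count 2 = 0) (hc : M'.count 2 = 0) : M' = zstate (a + 1) 0 1 0 R := by
  obtain ⟨N, hN, rfl⟩ := h.eq_of_count_two (by have := count_zstate a 2 0 0 R; omega)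
  have : N = zstate a 0 0 0 R := by
    have : ({2, 2} : Multiset ℕ) + zstate a 0 0 0 R = {2, 2} + N := by
      rw [← hN]
      simp only [zstate, Multiset.insert_eq_cons, ← Multiset.singleton_add, two_smul, zero_smul]
      abel
    exact (add_left_cancel this).symm
  subst this
  simp only [zstate, Multiset.insert_eq_cons, ← Multiset.singleton_add, add_smul]
  abel

section Alliance

variable {p : ℕ} {S : Set ℕ} {t : ℕ} {M : Multiset ℕ}

theorem zWins_of_two_of_count_two (hk : ∀ t, t % p ∉ S → (t + 1) % p ∈ S)
    (h0 : t % p ∈ S) (h1 : (t + 1) % p ∈ S)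
    (hc1 : 4 ≤ M.count 1) (hc2 : 1 ≤ M.count 2) : ZWins p S t M := by
  by_contra h
  obtain ⟨R, rfl⟩ := exists_eq_zstate (c := 0) hc1 hc2 (Nat.zero_le _)
  have short := not_zWins_succ h0 h (zMove_one_two 3 0 0 0 R)
  have long := not_zWins_succ h1 (not_zWins_succ h0 h (zMove_one_one 2 1 0 0 R))
    (zMove_two_two 2 0 0 0 R)
  exact long (zWins_add_of_not_zWins hk ⟨_, zMove_one_one 1 0 1 0 R⟩ short)

theorem zWins_of_three (hk : ∀ t, t % p ∉ S → (t + 1) % p ∈ S)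
    (h0 : t % p ∈ S) (h1 : (t + 1) % p ∈ S) (h2 : (t + 2) % p ∈ S)
    (hc1 : 6 ≤ M.count 1) : ZWins p S t M := by
  obtain ⟨R, rfl⟩ := exists_eq_zstate (b := 0) (c := 0) hc1 (Nat.zero_le _) (Nat.zero_le _)
  have hc := count_zstate 4 1 0 0 R
  exact .mine_step _ _ _ h0 (zMove_one_one 4 0 0 0 R)
    (zWins_of_two_of_count_two hk h1 h2 (by rw [zero_add]; omega) (by rw [zero_add]; omega))

theorem zWins_of_two_two (hk : ∀ t, t % p ∉ S → (t + 1) % p ∈ S)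
    (h0 : t % p ∈ S) (h1 : (t + 1) % p ∈ S) (h3 : (t + 3) % p ∈ S) (h4 : (t + 4) % p ∈ S)
    (hc1 : 10 ≤ M.count 1) : ZWins p S t M := by
  by_contra h
  have hM2 : M.count 2 = 0 := by
    by_contra hM2
    exact h (zWins_of_two_of_count_two hk h0 h1 (by omega) (by omega))
  obtain ⟨R, rfl⟩ := exists_eq_zstate (b := 0) (c := 0) hc1 (Nat.zero_le _) (Nat.zero_le _)
  have hR : R.count 2 = 0 := by have := count_zstate 10 0 0 0 R; omega
  have first := not_zWins_succ h0 h (zMove_one_one 8 0 0 0 R)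
  have twos : ¬ ZWins p S (t + 2) (zstate 6 2 0 0 R) :=
    not_zWins_succ h1 first (zMove_one_one 6 1 0 0 R)
  have short := not_zWins_succ h1 first (zMove_one_two 7 0 0 0 R)
  obtain ⟨M', hmv, long⟩ := exists_zMove_not_zWins_succ twos ⟨_, zMove_one_one 4 2 0 0 R⟩
  have hM' : M'.count 2 = 0 := by
    by_contra hM'
    have := count_zstate 6 2 0 0 R
    have := hmv.count_cases
    exact long (zWins_of_two_of_count_two hk h3 h4 (by omega) (by omega))
  rw [hmv.zstate_eq hR hM'] at long
  exact long (zWins_add_of_not_zWins hk ⟨_, zMove_one_one 5 0 1 0 R⟩ short)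

theorem zWins_of_four_of_count_two (hk : ∀ t, t % p ∉ S → (t + 2) % p ∈ S)
    (h0 : t % p ∈ S) (h1 : (t + 1) % p ∈ S) (h2 : (t + 2) % p ∈ S) (h3 : (t + 3) % p ∈ S)
    (hc1 : 4 ≤ M.count 1) (hc2 : 2 ≤ M.count 2) : ZWins p S t M := by
  by_contra h
  obtain ⟨R, rfl⟩ := exists_eq_zstate (c := 0) hc1 hc2 (Nat.zero_le _)
  have short := not_zWins_succ h1 (not_zWins_succ h0 h (zMove_one_two 3 1 0 0 R))
    (zMove_one_two 2 0 1 0 R)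
  have long := not_zWins_succ h3 (not_zWins_succ h2 (not_zWins_succ h1 (not_zWins_succ h0 h
    (zMove_one_one 2 2 0 0 R)) (zMove_one_one 0 3 0 0 R)) (zMove_two_two 0 2 0 0 R))
    (zMove_two_two 1 0 1 0 R)
  exact long (zWins_add_of_not_zWins (k := 2) hk ⟨_, zMove_one_one 0 0 2 0 R⟩ short)

theorem zWins_of_four_of_count_three (hk : ∀ t, t % p ∉ S → (t + 2) % p ∈ S)
    (h0 : t % p ∈ S) (h1 : (t + 1) % p ∈ S) (h2 : (t + 2) % p ∈ S) (h3 : (t + 3) % p ∈ S)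
    (hc1 : 4 ≤ M.count 1) (hc3 : 1 ≤ M.count 3) : ZWins p S t M := by
  by_contra h
  obtain ⟨R, rfl⟩ := exists_eq_zstate (b := 0) hc1 (Nat.zero_le _) hc3
  have first := not_zWins_succ h0 h (zMove_one_one 2 0 1 0 R)
  have short := not_zWins_succ h1 first (zMove_two_three 2 0 0 0 R)
  have long := not_zWins_succ h3 (not_zWins_succ h2 (not_zWins_succ h1 first
    (zMove_one_one 0 1 1 0 R)) (zMove_two_two 0 0 1 0 R)) (zMove_three_three 1 0 0 0 R)
  exact long (zWins_add_of_not_zWins (k := 2) hk ⟨_, zMove_one_one 0 0 0 1 R⟩ short)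

/-- Four consecutive members of `S` play `1 + 1 = 2`, then two arbitrary moves are made. -/
theorem exists_not_zWins_add_six (h0 : t % p ∈ S) (h1 : (t + 1) % p ∈ S) (h2 : (t + 2) % p ∈ S)
    (h3 : (t + 3) % p ∈ S) (hc1 : 12 ≤ M.count 1) (h : ¬ ZWins p S t M) :
    ∃ N M₁ M', N.count 1 + 8 = M.count 1 ∧ N.count 2 = M.count 2 + 4 ∧
      N.count 3 = M.count 3 ∧ ZMove N M₁ ∧ ZMove M₁ M' ∧ ¬ ZWins p S (t + 6) M' := by
  obtain ⟨R, rfl⟩ := exists_eq_zstate (b := 0) (c := 0) hc1 (Nat.zero_le _) (Nat.zero_le _)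
  have hN : ¬ ZWins p S (t + 4) (zstate 4 4 0 0 R) := not_zWins_succ h3 (not_zWins_succ h2 (not_zWins_succ h1 (not_zWins_succ h0 h
    (zMove_one_one 10 0 0 0 R)) (zMove_one_one 8 1 0 0 R)) (zMove_one_one 6 2 0 0 R))
    (zMove_one_one 4 3 0 0 R)
  have c0 := count_zstate 12 0 0 0 R
  have c4 := count_zstate 4 4 0 0 R
  obtain ⟨M₁, hmv₁, hM₁⟩ := exists_zMove_not_zWins_succ hN ⟨_, zMove_one_one 2 4 0 0 R⟩
  have := hmv₁.count_cases
  obtain ⟨M', hmv', hM'⟩ :=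
    exists_zMove_not_zWins_succ hM₁ (exists_zMove_of_count_one (by omega))
  exact ⟨_, M₁, M', by omega, by omega, by omega, hmv₁, hmv', hM'⟩

theorem zWins_of_four (hk : ∀ t, t % 6 ∉ S → (t + 2) % 6 ∈ S)
    (h0 : t % 6 ∈ S) (h1 : (t + 1) % 6 ∈ S) (h2 : (t + 2) % 6 ∈ S) (h3 : (t + 3) % 6 ∈ S)
    (hc1 : 20 ≤ M.count 1) (hw : 95 ≤ 4 * M.count 1 + 3 * M.count 2 + 2 * M.count 3) :
    ZWins 6 S t M := by
  have rot : ∀ {i}, (t + i) % 6 ∈ S → (t + 6 + i) % 6 ∈ S ∧ (t + 6 + 6 + i) % 6 ∈ S := by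
    intro i hi
    constructor
    · rwa [show t + 6 + i = t + i + 6 by ring, Nat.add_mod_right]
    · rwa [show t + 6 + 6 + i = t + i + 6 + 6 by ring, Nat.add_mod_right, Nat.add_mod_right]
  by_contra h
  have few : ∀ {M : Multiset ℕ} {t : ℕ}, t % 6 ∈ S → (t + 1) % 6 ∈ S → (t + 2) % 6 ∈ S →
      (t + 3) % 6 ∈ S → 4 ≤ M.count 1 → ¬ ZWins 6 S t M → M.count 2 ≤ 1 ∧ M.count 3 = 0 := by
    intro M t h0 h1 h2 h3 hc hl
    by_contra hcon
    by_cases hM2 : 2 ≤ M.count 2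
    · exact hl (zWins_of_four_of_count_two hk h0 h1 h2 h3 hc hM2)
    · exact hl (zWins_of_four_of_count_three hk h0 h1 h2 h3 hc (by omega))
  have hM := few h0 h1 h2 h3 (by omega) h
  obtain ⟨N, M₁, M', n1, n2, n3, hmv₁, hmv', h'⟩ :=
    exists_not_zWins_add_six h0 h1 h2 h3 (by omega) h
  have d₁ := hmv₁.count_cases
  have d' := hmv'.count_cases
  have hM' := few (rot (i := 0) h0).1 (rot h1).1 (rot h2).1 (rot h3).1 (by omega) h'
  have key : 16 ≤ M'.count 1 ∧ M'.count 2 = 1 := by omega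
  obtain ⟨N', M₂, M'', m1, m2, m3, hmv₂, hmv'', h''⟩ :=
    exists_not_zWins_add_six (rot (i := 0) h0).1 (rot h1).1 (rot h2).1 (rot h3).1 (by omega) h'
  clear d₁ d'
  have e₁ := hmv₂.count_cases
  have e' := hmv''.count_cases
  have hM'' := few (rot (i := 0) h0).2 (rot h1).2 (rot h2).2 (rot h3).2 (by omega) h''
  omega

/-- Play reaches turn `t` with many `1`s left, since a move lowers `4 c₁ + 3 c₂ + 2 c₃` by at most
`5`. -/
theorem exists_not_zWins_zstart {n : ℕ} (h : ¬ ZWins p S 0 (zstart n)) (t : ℕ)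
    (ht : 2 * t ≤ n) :
    ∃ M, ¬ ZWins p S t M ∧ n ≤ M.count 1 + 2 * t ∧
      4 * n ≤ 4 * M.count 1 + 3 * M.count 2 + 2 * M.count 3 + 5 * t := by
  induction t with
  | zero => exact ⟨_, h, by simp [zstart], by simp [zstart]; omega⟩
  | succ t ih =>
    obtain ⟨M, hM, hc, hw⟩ := ih (by omega)
    obtain ⟨M', hmv, hM'⟩ := exists_zMove_not_zWins_succ hM (exists_zMove_of_count_one (by omega))
    have := hmv.count_cases
    exact ⟨M', hM', by omega, by omega⟩

end Alliance

/-- If the opponents are not adjacent, they can be rotated by one seat into the alliance, which has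
two suitable pairs of consecutive turns; otherwise rotation by two seats does, and the alliance has
four consecutive turns. -/
theorem seating_cases : ∀ A ∈ (Finset.range 6).powersetCard 4,
    ((∀ r < 6, r ∉ A → (r + 1) % 6 ∈ A) ∧ ∃ s < 6, s ∈ A ∧ (s + 1) % 6 ∈ A ∧
      ((s + 2) % 6 ∈ A ∨ ((s + 3) % 6 ∈ A ∧ (s + 4) % 6 ∈ A))) ∨
    ((∀ r < 6, r ∉ A → (r + 2) % 6 ∈ A) ∧ ∃ s < 6, s ∈ A ∧ (s + 1) % 6 ∈ A ∧
      (s + 2) % 6 ∈ A ∧ (s + 3) % 6 ∈ A) := by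
  decide

/-- In the 6-player Zeckendorf game on `n ≥ 30` with two alliances of sizes 4
and 2, the 4-player alliance has a winning strategy, regardless of seating. -/
theorem stmt_12 (n : ℕ) (hn : 30 ≤ n) (A : Finset ℕ)
    (hA : A ⊆ Finset.range 6) (hcard : A.card = 4) :
    ZWins 6 (↑A) 0 (zstart n) := by
  have rot : ∀ {k}, (∀ r < 6, r ∉ A → (r + k) % 6 ∈ A) →
      ∀ t, t % 6 ∉ (A : Set ℕ) → (t + k) % 6 ∈ (A : Set ℕ) := fun hk t ht => by
    simpa using hk (t % 6) (Nat.mod_lt _ (by norm_num)) (by simpa using ht)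
  by_contra h
  obtain ⟨hk, s, hs, h0, h1, h2⟩ | ⟨hk, s, hs, h0, h1, h2, h3⟩ :=
    seating_cases A (Finset.mem_powersetCard.mpr ⟨hA, hcard⟩)
  · obtain ⟨M, hM, hc, -⟩ := exists_not_zWins_zstart h s (by omega)
    rw [← Nat.mod_eq_of_lt hs] at h0
    obtain h2 | ⟨h3, h4⟩ := h2
    · exact hM (zWins_of_three (rot hk) h0 h1 h2 (by omega))
    · exact hM (zWins_of_two_two (rot hk) h0 h1 h3 h4 (by omega))
  · obtain ⟨M, hM, hc, hw⟩ := exists_not_zWins_zstart h s (by omega)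
    rw [← Nat.mod_eq_of_lt hs] at h0
    exact hM (zWins_of_four (rot hk) h0 h1 h2 h3 (by omega) (by omega))
end

section
/- In the p-player Zeckendorf game with p ≥ 7, n ≥ 32, and two alliances where one alliance has p − 2 players and the other has exactly 2 players, the big (p−2)-player alliance always has a winning strategy, regardless of the seating arrangement. -/
namespace ZMove

/-- A natural number that strictly decreases along every move. -/
def potential (M : Multiset ℕ) : ℕ := 2 * M.sum + 2 * M.card + M.count 2

theorem potential_lt {M M' : Multiset ℕ} (h : ZMove M M') : potential M' < potential M := by
  cases h with
  | combine i R hi =>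
    simp only [potential, Multiset.insert_eq_cons, Multiset.sum_add, Multiset.sum_cons,
      Multiset.sum_singleton, Multiset.card_add, Multiset.card_cons, Multiset.card_singleton,
      Multiset.count_add, Multiset.count_cons, Multiset.count_singleton]
    split_ifs <;> omega
  | combine1 R => simp [potential]; omega
  | split2 R => simp [potential]; omega
  | split i R hi =>
    simp only [potential, Multiset.insert_eq_cons, Multiset.sum_add, Multiset.sum_cons,
      Multiset.sum_singleton, Multiset.card_add, Multiset.card_cons, Multiset.card_singleton,
      Multiset.count_add, Multiset.count_cons, Multiset.count_singleton]
    split_ifs <;> omega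

/-- How a move can change the numbers of `1`s and `2`s. -/
theorem count_bounds {M M' : Multiset ℕ} (h : ZMove M M') :
    (M.count 1 ≤ M'.count 1 + 2 ∧ M.count 2 + 1 ≤ M'.count 2) ∨
    (M.count 1 ≤ M'.count 1 + 1 ∧ M.count 2 ≤ M'.count 2 + 1) ∨
    (M.count 1 + 1 ≤ M'.count 1 ∧ M.count 2 ≤ M'.count 2 + 2) := by
  cases h with
  | combine i R hi =>
    simp only [Multiset.insert_eq_cons, Multiset.count_add, Multiset.count_cons,
      Multiset.count_singleton]
    split_ifs <;> omega
  | combine1 R => simp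
  | split2 R => simp
  | split i R hi =>
    simp only [Multiset.insert_eq_cons, Multiset.count_add, Multiset.count_cons,
      Multiset.count_singleton]
    split_ifs <;> omega

theorem exists_eq_add_of_count {a b : ℕ} {M : Multiset ℕ}
    (h₁ : a ≤ M.count 1) (h₂ : b ≤ M.count 2) :
    ∃ R, M = (Multiset.replicate a 1 + Multiset.replicate b 2) + R := by
  have hle : Multiset.replicate a 1 + Multiset.replicate b 2 ≤ M := by
    rw [Multiset.le_iff_count]
    intro c
    simp only [Multiset.count_add, Multiset.count_replicate]
    split_ifs <;> subst_vars <;> omega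
  obtain ⟨R, hR⟩ := Multiset.le_iff_exists_add.mp hle
  exact ⟨R, hR⟩

theorem exists_combine1 {M : Multiset ℕ} (h : 2 ≤ M.count 1) :
    ∃ M', ZMove M M' ∧ M.count 1 = M'.count 1 + 2 ∧ M'.count 2 = M.count 2 + 1 := by
  obtain ⟨R, rfl⟩ := exists_eq_add_of_count (b := 0) h (Nat.zero_le _)
  refine ⟨{2} + R, ?_, ?_, ?_⟩
  · simpa [Multiset.replicate_succ] using combine1 R
  · simp
  · simp

/-- The state with `a` ones, `b` twos, `c` threes and the remaining part `R`. -/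
def board (a b c : ℕ) (R : Multiset ℕ) : Multiset ℕ :=
  a • {1} + b • {2} + c • {3} + R

theorem exists_eq_board {a b : ℕ} {M : Multiset ℕ}
    (h₁ : a ≤ M.count 1) (h₂ : b ≤ M.count 2) : ∃ R, M = board a b 0 R := by
  obtain ⟨R, rfl⟩ := exists_eq_add_of_count h₁ h₂
  exact ⟨R, by simp [board, Multiset.nsmul_singleton]⟩

theorem board_combine1 (a b c : ℕ) (R : Multiset ℕ) :
    ZMove (board (a + 2) b c R) (board a (b + 1) c R) := by
  convert combine1 (board a b c R) using 1 <;>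
    simp only [board, Multiset.insert_eq_cons, ← Multiset.singleton_add] <;> module

theorem board_combine2 (a b c : ℕ) (R : Multiset ℕ) :
    ZMove (board (a + 1) (b + 1) c R) (board a b (c + 1) R) := by
  convert combine 2 (board a b c R) le_rfl using 1 <;>
    simp only [board, Multiset.insert_eq_cons, ← Multiset.singleton_add] <;> module

theorem board_split2 (a b c : ℕ) (R : Multiset ℕ) :
    ZMove (board a (b + 2) c R) (board (a + 1) b (c + 1) R) := by
  convert split2 (board a b c R) using 1 <;>
    simp only [board, Multiset.insert_eq_cons, ← Multiset.singleton_add] <;> module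

theorem board_combine3 (a b c : ℕ) (R : Multiset ℕ) :
    ∃ N, ZMove (board a (b + 1) (c + 1) R) N := by
  refine ⟨{4} + board a b c R, ?_⟩
  convert combine 3 (board a b c R) (by norm_num) using 1
  simp only [board, Multiset.insert_eq_cons, ← Multiset.singleton_add]
  module

end ZMove

namespace ZWins

variable {p : ℕ} {S : Set ℕ} {t : ℕ} {M M' : Multiset ℕ}

theorem not_of_move (hS : t % p ∈ S) (h : ¬ ZWins p S t M) (hm : ZMove M M') :
    ¬ ZWins p S (t + 1) M' :=
  fun hw => h (mine_step t M M' hS hm hw)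

theorem exists_move_not (h : ¬ ZWins p S t M) (hne : ∃ M', ZMove M M') :
    ∃ M', ZMove M M' ∧ ¬ ZWins p S (t + 1) M' := by
  by_cases hS : t % p ∈ S
  · obtain ⟨M', hm⟩ := hne
    exact ⟨M', hm, not_of_move hS h hm⟩
  · by_contra! hc
    exact h (theirs t M hS hne hc)

/-- Strategy stealing: if at any time the mover in one of two shifted games belongs to `S`,
then `S` wins at least one of the two games. -/
theorem or_of_forall_mem_or {k : ℕ} (hk : ∀ t, t % p ∈ S ∨ (t + k) % p ∈ S) (M : Multiset ℕ) :
    ∀ t, (∃ M', ZMove M M') → ZWins p S t M ∨ ZWins p S (t + k) M := by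
  induction hM : ZMove.potential M using Nat.strong_induction_on generalizing M with
  | _ m ih =>
    subst hM
    intro t hne
    have ih' : ∀ M', ZMove M M' → (∃ N, ZMove M' N) →
        ZWins p S (t + 1) M' ∨ ZWins p S (t + k + 1) M' := fun M' hm hn => by
      have := ih _ hm.potential_lt M' rfl (t + 1) hn
      rwa [Nat.add_right_comm t 1 k] at this
    by_contra! hc
    by_cases h₁ : t % p ∈ S
    · obtain ⟨M', hm, hM'⟩ := exists_move_not hc.2 hne
      by_cases hn : ∃ N, ZMove M' N
      · exact (ih' M' hm hn).elim (not_of_move h₁ hc.1 hm) hM'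
      · exact hc.1 (mine_end t M M' h₁ hm (not_exists.mp hn))
    · have h₂ := (hk t).resolve_left h₁
      obtain ⟨M', hm, hM'⟩ := exists_move_not hc.1 hne
      by_cases hn : ∃ N, ZMove M' N
      · exact (ih' M' hm hn).elim hM' (not_of_move h₂ hc.2 hm)
      · exact hc.2 (mine_end _ M M' h₂ hm (not_exists.mp hn))

theorem exists_step_s13 (h : ¬ ZWins p S t M) (hc : 2 ≤ M.count 1) :
    ∃ M', ¬ ZWins p S (t + 1) M' ∧
      ((M.count 1 ≤ M'.count 1 + 2 ∧ M.count 2 + 1 ≤ M'.count 2) ∨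
      (M.count 1 ≤ M'.count 1 + 1 ∧ M.count 2 ≤ M'.count 2 + 1) ∨
      (M.count 1 + 1 ≤ M'.count 1 ∧ M.count 2 ≤ M'.count 2 + 2)) := by
  obtain ⟨N, hN, -⟩ := ZMove.exists_combine1 hc
  obtain ⟨M', hm, hM'⟩ := exists_move_not h ⟨N, hN⟩
  exact ⟨M', hM', hm.count_bounds⟩

theorem exists_steps (h : ¬ ZWins p S t M) (k : ℕ) (hc : 2 * k ≤ M.count 1) :
    ∃ M', ¬ ZWins p S (t + k) M' ∧ M.count 1 ≤ M'.count 1 + 2 * k := by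
  induction k with
  | zero => exact ⟨M, h, by omega⟩
  | succ k ih =>
    obtain ⟨N, hN, hN'⟩ := ih (by omega)
    obtain ⟨M', hM', hb⟩ := exists_step_s13 hN (by omega)
    exact ⟨M', hM', by omega⟩

theorem exists_combine1_steps (h : ¬ ZWins p S t M) (k : ℕ) (hS : ∀ i < k, (t + i) % p ∈ S)
    (hc : 2 * k ≤ M.count 1) :
    ∃ M', ¬ ZWins p S (t + k) M' ∧ M.count 1 = M'.count 1 + 2 * k ∧
      M'.count 2 = M.count 2 + k := by
  induction k with
  | zero => exact ⟨M, h, by omega, by omega⟩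
  | succ k ih =>
    obtain ⟨N, hN, hN'⟩ := ih (fun i hi => hS i (by omega)) (by omega)
    obtain ⟨M', hm, hb⟩ := ZMove.exists_combine1 (M := N) (by omega)
    exact ⟨M', not_of_move (hS k (by omega)) hN hm, by omega, by omega⟩

theorem of_three_mem (hk : ∀ t, t % p ∈ S ∨ (t + 1) % p ∈ S)
    (hS : ∀ i < 3, (t + i) % p ∈ S) (hc : 6 ≤ M.count 1) : ZWins p S t M := by
  by_contra h
  obtain ⟨R, rfl⟩ := ZMove.exists_eq_board (b := 0) hc (Nat.zero_le _)
  have h₁ := not_of_move (hS 0 (by norm_num)) h (ZMove.board_combine1 4 0 0 R)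
  have short := not_of_move (hS 1 (by norm_num)) h₁ (ZMove.board_combine2 3 0 0 R)
  have h₂ := not_of_move (hS 1 (by norm_num)) h₁ (ZMove.board_combine1 2 1 0 R)
  have long := not_of_move (hS 2 (by norm_num)) h₂ (ZMove.board_split2 2 0 0 R)
  exact (or_of_forall_mem_or hk _ _ ⟨_, ZMove.board_combine1 1 0 1 R⟩).elim short long

theorem of_five_mem (hk : ∀ t, t % p ∈ S ∨ (t + 2) % p ∈ S)
    (hS : ∀ i < 5, (t + i) % p ∈ S) (hc : 4 ≤ M.count 1) (hc' : 2 ≤ M.count 2) :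
    ZWins p S t M := by
  by_contra h
  obtain ⟨R, rfl⟩ := ZMove.exists_eq_board hc hc'
  have h₁ := not_of_move (hS 0 (by norm_num)) h (ZMove.board_combine1 2 2 0 R)
  have s₂ := not_of_move (hS 1 (by norm_num)) h₁ (ZMove.board_combine2 1 2 0 R)
  have short := not_of_move (hS 2 (by norm_num)) s₂ (ZMove.board_combine2 0 1 1 R)
  have l₂ := not_of_move (hS 1 (by norm_num)) h₁ (ZMove.board_split2 2 1 0 R)
  have l₃ := not_of_move (hS 2 (by norm_num)) l₂ (ZMove.board_combine1 1 1 1 R)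
  have l₄ := not_of_move (hS 3 (by norm_num)) l₃ (ZMove.board_split2 1 0 1 R)
  have long := not_of_move (hS 4 (by norm_num)) l₄ (ZMove.board_combine1 0 0 2 R)
  exact (or_of_forall_mem_or hk _ _ (ZMove.board_combine3 0 0 1 R)).elim short long

theorem of_six_mem (hk : ∀ t, t % p ∈ S ∨ (t + 2) % p ∈ S)
    (hS : ∀ i < 6, (t + i) % p ∈ S) (hc : 8 ≤ M.count 1) : ZWins p S t M := by
  by_contra h
  obtain ⟨R, rfl⟩ := ZMove.exists_eq_board (b := 0) hc (Nat.zero_le _)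
  have h₁ := not_of_move (hS 0 (by norm_num)) h (ZMove.board_combine1 6 0 0 R)
  have h₂ := not_of_move (hS 1 (by norm_num)) h₁ (ZMove.board_combine1 4 1 0 R)
  have s₃ := not_of_move (hS 2 (by norm_num)) h₂ (ZMove.board_combine2 3 1 0 R)
  have short := not_of_move (hS 3 (by norm_num)) s₃ (ZMove.board_combine2 2 0 1 R)
  have l₃ := not_of_move (hS 2 (by norm_num)) h₂ (ZMove.board_combine1 2 2 0 R)
  have l₄ := not_of_move (hS 3 (by norm_num)) l₃ (ZMove.board_split2 2 1 0 R)
  have l₅ := not_of_move (hS 4 (by norm_num)) l₄ (ZMove.board_combine1 1 1 1 R)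
  have long := not_of_move (hS 5 (by norm_num)) l₅ (ZMove.board_split2 1 0 1 R)
  exact (or_of_forall_mem_or hk _ _ ⟨_, ZMove.board_combine1 0 0 2 R⟩).elim short long

theorem seven_of_count_two_pos (hk : ∀ t, t % 7 ∈ S ∨ (t + 2) % 7 ∈ S)
    (hS : ∀ i < 5, (t + i) % 7 ∈ S) (hc : 18 ≤ M.count 1) (hc' : 1 ≤ M.count 2) :
    ZWins 7 S t M := by
  by_contra h
  obtain ⟨M₁, h₁, _, _⟩ := exists_combine1_steps h 5 hS (by omega)
  obtain ⟨M₂, h₂, _⟩ := exists_step_s13 h₁ (by omega)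
  obtain ⟨M₃, h₃, _⟩ := exists_step_s13 h₂ (by omega)
  refine h₃ (of_five_mem hk (fun i hi => ?_) (by omega) (by omega))
  rw [show (t + 5 + 1 + 1 + i) % 7 = (t + i) % 7 by omega]
  exact hS i hi

theorem seven_of_block (hk : ∀ t, t % 7 ∈ S ∨ (t + 2) % 7 ∈ S)
    (hS : ∀ i < 5, (t + i) % 7 ∈ S)
    (hc : 26 ≤ M.count 1 ∨ 18 ≤ M.count 1 ∧ 1 ≤ M.count 2) : ZWins 7 S t M := by
  rcases hc with hc | hc
  · by_contra h
    obtain ⟨M₁, h₁, _, _⟩ := exists_combine1_steps h 5 hS (by omega)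
    obtain ⟨M₂, h₂, _⟩ := exists_step_s13 h₁ (by omega)
    obtain ⟨M₃, h₃, _⟩ := exists_step_s13 h₂ (by omega)
    have hS' : ∀ i < 5, (t + 5 + 1 + 1 + i) % 7 ∈ S := fun i hi => by
      rw [show (t + 5 + 1 + 1 + i) % 7 = (t + i) % 7 by omega]
      exact hS i hi
    by_cases hy : 2 ≤ M₃.count 2
    · exact h₃ (of_five_mem hk hS' (by omega) hy)
    · exact h₃ (seven_of_count_two_pos hk hS' (by omega) (by omega))
  · exact seven_of_count_two_pos hk hS hc.1 hc.2

/-- With seven players, `S` wins if its five members play consecutively and enough `1`s are left,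
whatever number `r` of them moves before the opponents do for the first time. -/
theorem seven_of_initial_moves (hk : ∀ t, t % 7 ∈ S ∨ (t + 2) % 7 ∈ S) {r : ℕ} (hr : r ≤ 5)
    (h₀ : ∀ i < r, i % 7 ∈ S) (hS : ∀ i < 5, (r + 2 + i) % 7 ∈ S)
    (hc : 32 ≤ M.count 1) : ZWins 7 S 0 M := by
  by_contra h
  obtain ⟨M₁, h₁, _, _⟩ := exists_combine1_steps h r (by simpa using h₀) (by omega)
  obtain ⟨M₂, h₂, _⟩ := exists_step_s13 h₁ (by omega)
  obtain ⟨M₃, h₃, _⟩ := exists_step_s13 h₂ (by omega)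
  refine h₃ (seven_of_block hk (fun i hi => ?_) (by omega))
  rw [show 0 + r + 1 + 1 + i = r + 2 + i by omega]
  exact hS i hi

end ZWins

theorem Nat.mod_eq_ite_sub {s p : ℕ} (h : s < 2 * p) : s % p = if s < p then s else s - p := by
  split_ifs with hs
  · exact Nat.mod_eq_of_lt hs
  · rw [Nat.mod_eq_sub_mod (by omega), Nat.mod_eq_of_lt (by omega)]

/-- A set of `p - 2` players misses exactly two players. -/
theorem exists_forall_mem_iff_ne_and_ne {p : ℕ} (hp : 2 ≤ p) {A : Finset ℕ}
    (hA : A ⊆ Finset.range p) (hcard : A.card = p - 2) :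
    ∃ a b, a < b ∧ b < p ∧ ∀ i < p, i ∈ A ↔ i ≠ a ∧ i ≠ b := by
  have h₂ : (Finset.range p \ A).card = 2 := by
    rw [Finset.card_sdiff_of_subset hA, Finset.card_range]
    omega
  obtain ⟨a, b, hab, he⟩ := Finset.card_eq_two.mp h₂
  have hm : ∀ i, i < p ∧ i ∉ A ↔ i = a ∨ i = b := fun i => by
    have := congrArg (i ∈ ·) he
    simpa using this
  have ha := (hm a).mpr (Or.inl rfl)
  have hb := (hm b).mpr (Or.inr rfl)
  have key : ∀ i < p, i ∈ A ↔ i ≠ a ∧ i ≠ b := fun i hi => by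
    have := hm i
    tauto
  rcases hab.lt_or_gt with h | h
  · exact ⟨a, b, h, hb.1, key⟩
  · exact ⟨b, a, h, ha.1, fun i hi => (key i hi).trans and_comm⟩

/-- In the `p`-player Zeckendorf game with `p ≥ 7` and `n ≥ 32`, with one
alliance of `p - 2` players and one of 2 players, the big alliance has a
winning strategy, regardless of seating. -/
theorem stmt_13 (p n : ℕ) (hp : 7 ≤ p) (hn : 32 ≤ n) (A : Finset ℕ)
    (hA : A ⊆ Finset.range p) (hcard : A.card = p - 2) :
    ZWins p (↑A) 0 (zstart n) := by 
  obtain ⟨a, b, hab, hb, hmem⟩ := exists_forall_mem_iff_ne_and_ne (by omega) hA hcard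
  have hmod : ∀ s, s < 2 * p → (if s < p then s else s - p) ≠ a →
      (if s < p then s else s - p) ≠ b → s % p ∈ (A : Set ℕ) := fun s hs h₁ h₂ => by
    rw [Finset.mem_coe, hmem _ (Nat.mod_lt _ (by omega)), Nat.mod_eq_ite_sub hs]
    exact ⟨h₁, h₂⟩
  have shift : ∀ k < p, (∀ u < p, (u ≠ a ∧ u ≠ b) ∨
      ((if u + k < p then u + k else u + k - p) ≠ a ∧
        (if u + k < p then u + k else u + k - p) ≠ b)) →
      ∀ t, t % p ∈ (A : Set ℕ) ∨ (t + k) % p ∈ (A : Set ℕ) := fun k hk h t => by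
    have hu : t % p < p := Nat.mod_lt _ (by omega)
    rw [← Nat.mod_add_mod]
    refine (h _ hu).imp (fun h => ?_) (fun h => hmod _ (by omega) h.1 h.2)
    exact (hmem _ hu).mpr h
  have hcount : (zstart n).count 1 = n := by simp [zstart]
  by_contra hlose
  have later : ∀ t ≤ 7, ∃ M, ¬ ZWins p A t M ∧ 18 ≤ M.count 1 := fun t ht => by
    obtain ⟨M, hM, hc⟩ := ZWins.exists_steps hlose t (by omega)
    exact ⟨M, by rwa [Nat.zero_add] at hM, by omega⟩
  by_cases hadj : b = a + 1 ∨ (a = 0 ∧ b = p - 1)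
  · have h2 := shift 2 (by omega) (fun u hu => by split_ifs <;> omega)
    by_cases hp7 : p = 7
    · subst hp7
      by_cases hends : a = 0 ∧ b = 6
      · obtain ⟨M, hM, hb⟩ := ZWins.exists_step_s13 hlose (by omega)
        refine hM (ZWins.seven_of_block h2 (fun i hi => ?_) (by omega))
        exact hmod _ (by omega) (by split_ifs <;> omega) (by split_ifs <;> omega)
      · refine hlose (ZWins.seven_of_initial_moves (r := a) h2 (by omega) (fun i hi => ?_)
          (fun i hi => ?_) (by omega)) <;>
        exact hmod _ (by omega) (by split_ifs <;> omega) (by split_ifs <;> omega)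
    · obtain ⟨t, ht, hS⟩ : ∃ t ≤ 7, ∀ i < 6, (t + i) % p ∈ (A : Set ℕ) := by
        by_cases ha : 6 ≤ a
        · refine ⟨0, by omega, fun i hi => ?_⟩
          exact hmod _ (by omega) (by split_ifs <;> omega) (by split_ifs <;> omega)
        · by_cases hends : b = a + 1
          · refine ⟨a + 2, by omega, fun i hi => ?_⟩
            exact hmod _ (by omega) (by split_ifs <;> omega) (by split_ifs <;> omega)
          · refine ⟨1, by omega, fun i hi => ?_⟩
            exact hmod _ (by omega) (by split_ifs <;> omega) (by split_ifs <;> omega)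
      obtain ⟨M, hM, hc⟩ := later t ht
      exact hM (ZWins.of_six_mem h2 hS (by omega))
  · have h1 := shift 1 (by omega) (fun u hu => by split_ifs <;> omega)
    obtain ⟨t, ht, hS⟩ : ∃ t ≤ 7, ∀ i < 3, (t + i) % p ∈ (A : Set ℕ) := by
      by_cases ha : 3 ≤ a
      · refine ⟨0, by omega, fun i hi => ?_⟩
        exact hmod _ (by omega) (by split_ifs <;> omega) (by split_ifs <;> omega)
      · by_cases hgap : a + 4 ≤ b
        · refine ⟨a + 1, by omega, fun i hi => ?_⟩
          exact hmod _ (by omega) (by split_ifs <;> omega) (by split_ifs <;> omega)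
        · refine ⟨b + 1, by omega, fun i hi => ?_⟩
          exact hmod _ (by omega) (by split_ifs <;> omega) (by split_ifs <;> omega)
    obtain ⟨M, hM, hc⟩ := later t ht
    exact hM (ZWins.of_three_mem h1 hS (by omega))
end
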